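/- Under the stratification assumption and unconfoundedness with overlap under P, let π*(X) be a version of E_{P*}[D|σ(X)] satisfying c ≤ π*(X) ≤ 1 − c P*-almost surely for some c ∈ (0, 1/2), and suppose Y is integrable under P and P*. Then the reweighted inverse-propensity-score expression identifies the average treatment effect: E_{P*}[ (D·Y/π*(X) − (1−D)·Y/(1−π*(X))) · (π*(X)·π/π* + (1−π*(X))·(1−π)/(1−π*)) ] = E_P[Y₁ − Y₀]. -/

import Mathlib

open MeasureTheory ProbabilityTheory

theorem aux_pull {Ω 𝓧 : Type*} [MeasurableSpace Ω] [MeasurableSpace 𝓧]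
    (P : Measure Ω) [IsProbabilityMeasure P] (X : Ω → 𝓧) (hX : Measurable X)
    (A : Set Ω) (hA : MeasurableSet A) (k : Ω → ℝ)
    (hk : P[A.indicator (fun _ => (1:ℝ)) | MeasurableSpace.comap X inferInstance] =ᵐ[P] k)
    (g : 𝓧 → ℝ) (hg : Measurable g) (C : ℝ) (hC : ∀ x, |g x| ≤ C) :
    ∫ ω in A, g (X ω) ∂P = ∫ ω, g (X ω) * k ω ∂P := by
  have hgX : StronglyMeasurable[MeasurableSpace.comap X inferInstance] (fun ω => g (X ω)) :=
    (hg.comp (comap_measurable X)).stronglyMeasurable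
  have hint : Integrable (A.indicator (fun _ => (1:ℝ))) P :=
    (integrable_const _).indicator hA
  have h1 := condExp_stronglyMeasurable_mul_of_bound hX.comap_le hgX hint C
    (Filter.Eventually.of_forall fun ω => hC (X ω))
  rw [← integral_indicator hA]
  have e1 : (A.indicator fun ω => g (X ω)) =
      (fun ω => g (X ω)) * A.indicator (fun _ => (1:ℝ)) := by
    ext ω; by_cases h : ω ∈ A <;> simp [h]
  rw [e1, ← integral_condExp hX.comap_le]
  apply integral_congr_ae
  filter_upwards [h1, hk] with ω h1 h2
  rw [h1]; simp [h2]

theorem aux_half {Ω 𝓧 : Type*} [MeasurableSpace Ω] [MeasurableSpace 𝓧]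
    (P Q : Measure Ω) [IsProbabilityMeasure P] [IsProbabilityMeasure Q]
    (X : Ω → 𝓧) (hX : Measurable X) (Z : Ω → ℝ) (hZ : Measurable Z)
    (T : Set Ω) (hT : MeasurableSet T) (a b : ℝ) (ha : 0 < a) (hb : 0 < b)
    (hcond : ∀ s, MeasurableSet s →
      P[(Z ⁻¹' s ∩ T).indicator (fun _ => (1:ℝ)) | MeasurableSpace.comap X inferInstance] =ᵐ[P]
      fun ω => (P[(Z ⁻¹' s).indicator (fun _ => (1:ℝ)) | MeasurableSpace.comap X inferInstance]) ω *
        (P[T.indicator (fun _ => (1:ℝ)) | MeasurableSpace.comap X inferInstance]) ω)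
    (hs1 : ∀ f : ℝ × 𝓧 → ℝ, Measurable f →
      ∫ ω in T, f (Z ω, X ω) ∂P = a * ∫ ω in T, f (Z ω, X ω) ∂Q)
    (hs2 : ∀ g : 𝓧 → ℝ, Measurable g → ∫ ω in Tᶜ, g (X ω) ∂P = b * ∫ ω in Tᶜ, g (X ω) ∂Q)
    (q : 𝓧 → ℝ) (hqm : Measurable q)
    (hq : Q[T.indicator (fun _ => (1:ℝ)) | MeasurableSpace.comap X inferInstance] =ᵐ[Q]
      fun ω => q (X ω))
    (c : ℝ) (hc : 0 < c) (hql : ∀ x, c ≤ q x) (hqu : ∀ x, q x ≤ 1 - c) :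
    ∫ ω in T, Z ω / q (X ω) * (q (X ω) * a + (1 - q (X ω)) * b) ∂Q = ∫ ω, Z ω ∂P := by
  have hq0 : ∀ x, 0 < q x := fun x => hc.trans_le (hql x)
  have hq1 : ∀ x, 0 < 1 - q x := fun x => by linarith [hqu x]
  have hw0 : ∀ x, 0 < q x * a + (1 - q x) * b := fun x => by
    have := mul_pos (hq0 x) ha
    have := mul_pos (hq1 x) hb
    linarith
  set h : 𝓧 → ℝ := fun x => (q x * a + (1 - q x) * b) / (a * q x) with hh
  set e : 𝓧 → ℝ := fun x => (a * q x) / (q x * a + (1 - q x) * b) with he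
  have hhm : Measurable h := by fun_prop
  have hem : Measurable e := by fun_prop
  have hh0 : ∀ x, 0 ≤ h x := fun x => (div_pos (hw0 x) (mul_pos ha (hq0 x))).le
  have he0 : ∀ x, 0 ≤ e x := fun x => (div_pos (mul_pos ha (hq0 x)) (hw0 x)).le
  have hhe : ∀ x, h x * e x = 1 := fun x => by
    have := (hw0 x).ne'
    have := (hq0 x).ne'
    simp only [hh, he]; field_simp
  have heb : ∀ x, |e x| ≤ 1 := fun x => by
    rw [abs_of_nonneg (he0 x), div_le_one (hw0 x)]
    nlinarith [mul_pos (hq1 x) hb]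
  have hhb : ∀ x, |h x| ≤ (a + b) / (a * c) := fun x => by
    rw [abs_of_nonneg (hh0 x)]
    apply div_le_div₀ (by positivity) _ (by positivity) (by gcongr; exact hql x)
    nlinarith [mul_pos (hq1 x) ha, mul_pos (hq0 x) hb]
  have bint : ∀ (M : Measure Ω) [IsProbabilityMeasure M] (g : 𝓧 → ℝ) (C : ℝ), Measurable g →
      (∀ x, |g x| ≤ C) → Integrable (fun ω => g (X ω)) M := fun M _ g C hg hC =>
    Integrable.of_bound (hg.comp hX).aestronglyMeasurable C
      (Filter.Eventually.of_forall fun ω => hC (X ω))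
  -- step 1
  have step1 : (fun ω => e (X ω)) =ᵐ[P]
      P[T.indicator (fun _ => (1:ℝ)) | MeasurableSpace.comap X inferInstance] := by
    apply ae_eq_condExp_of_forall_setIntegral_eq hX.comap_le
      ((integrable_const _).indicator hT)
    · intro s _ _
      exact (bint P e 1 hem heb).integrableOn
    · rintro s ⟨B, hB, rfl⟩ -
      have hBX : MeasurableSet (X ⁻¹' B) := hX hB
      set g : 𝓧 → ℝ := B.indicator e with hg
      have hgm : Measurable g := hem.indicator hB
      have hgb : ∀ x, |g x| ≤ 1 := fun x => by
        by_cases hx : x ∈ B <;> simp [hg, hx, heb x]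
      have l1 : ∫ ω in X ⁻¹' B, e (X ω) ∂P = ∫ ω, g (X ω) ∂P := by
        rw [← integral_indicator hBX]; rfl
      have l2 := integral_add_compl hT (bint P g 1 hgm hgb)
      have l3 := integral_add_compl hT (bint Q g 1 hgm hgb)
      have l4 := hs1 (fun p => g p.2) (hgm.comp measurable_snd)
      have l5 := hs2 g hgm
      have l6 := aux_pull Q X hX T hT _ hq g hgm 1 hgb
      have l7 := aux_pull Q X hX T hT _ hq (B.indicator 1) (measurable_one.indicator hB) 1
        (fun x => by by_cases hx : x ∈ B <;> simp [hx])
      have l8 := hs1 (fun p => (B.indicator 1 : 𝓧 → ℝ) p.2)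
        ((measurable_one.indicator hB).comp measurable_snd)
      have r1 : ∫ ω in X ⁻¹' B, T.indicator (fun _ => (1:ℝ)) ω ∂P =
          ∫ ω in T, (B.indicator 1 : 𝓧 → ℝ) (X ω) ∂P := by
        rw [← integral_indicator hBX, ← integral_indicator hT]
        congr 1; ext ω
        by_cases h1 : ω ∈ T <;> by_cases h2 : X ω ∈ B <;> simp [h1, h2]
      have igq : Integrable (fun ω => g (X ω) * q (X ω)) Q :=
        bint Q (fun x => g x * q x) 1 (hgm.mul hqm) (fun x => by
          rw [abs_mul, abs_of_pos (hq0 x)]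
          have := hgb x
          have := hq1 x
          have := hq0 x
          nlinarith [abs_nonneg (g x)])
      have key : a * ∫ ω, (B.indicator 1 : 𝓧 → ℝ) (X ω) * q (X ω) ∂Q =
          (a - b) * (∫ ω, g (X ω) * q (X ω) ∂Q) + b * ∫ ω, g (X ω) ∂Q := by
        rw [← integral_const_mul, ← integral_const_mul, ← integral_const_mul,
          ← integral_add (igq.const_mul _) ((bint Q g 1 hgm hgb).const_mul _)]
        congr 1; ext ω
        by_cases h2 : X ω ∈ B
        · have hew : e (X ω) * (q (X ω) * a + (1 - q (X ω)) * b) = a * q (X ω) :=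
            div_mul_cancel₀ _ (hw0 (X ω)).ne'
          simp only [hg, h2, Set.indicator_of_mem, Pi.one_apply]
          linear_combination -hew
        · simp [hg, h2]
      simp only at l4 l8
      rw [l1, r1, l8, l7, key, ← l2, l4, l5, l6, ← l3, l6]; ring
    · exact ((hem.comp (comap_measurable X)).stronglyMeasurable).aestronglyMeasurable
  -- step 2
  have hmap : ((P.restrict T).withDensity (fun ω => ENNReal.ofReal (h (X ω)))).map Z = P.map Z := by
    ext s hs
    have hZs := hZ hs
    rw [Measure.map_apply hZ hs, Measure.map_apply hZ hs, withDensity_apply _ hZs,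
      Measure.restrict_restrict hZs, ← ofReal_integral_eq_lintegral_ofReal
        (bint P h _ hhm hhb).integrableOn (Filter.Eventually.of_forall fun ω => hh0 _),
      aux_pull P X hX _ (hZs.inter hT) _ (hcond s hs) h hhm _ hhb]
    have : ∫ ω, h (X ω) * ((P[(Z ⁻¹' s).indicator (fun _ => (1:ℝ)) | MeasurableSpace.comap X inferInstance]) ω *
        (P[T.indicator (fun _ => (1:ℝ)) | MeasurableSpace.comap X inferInstance]) ω) ∂P =
        ∫ ω, (P[(Z ⁻¹' s).indicator (fun _ => (1:ℝ)) | MeasurableSpace.comap X inferInstance]) ω ∂P := by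
      apply integral_congr_ae
      filter_upwards [step1] with ω h1
      rw [← h1]
      linear_combination ((P[(Z ⁻¹' s).indicator (fun _ => (1:ℝ)) | MeasurableSpace.comap X inferInstance]) ω) * hhe (X ω)
    rw [this, integral_condExp hX.comap_le, integral_indicator hZs]
    simp
  have s3 : ∫ ω, Z ω ∂P = ∫ ω in T, h (X ω) * Z ω ∂P := by
    have hid : AEStronglyMeasurable (fun y : ℝ => y) (P.map Z) :=
      measurable_id.aestronglyMeasurable
    have e1 := integral_map hZ.aemeasurable hid
    rw [← hmap] at hid e1
    rw [integral_map hZ.aemeasurable hid,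
      integral_withDensity_eq_integral_toReal_smul (by fun_prop) (by simp)] at e1
    rw [← e1]
    apply integral_congr_ae
    refine Filter.Eventually.of_forall fun ω => ?_
    simp [ENNReal.toReal_ofReal (hh0 _)]
  rw [s3, hs1 (fun p => h p.2 * p.1) (by fun_prop), ← integral_const_mul]
  congr 1; ext ω
  have := (hq0 (X ω)).ne'
  simp only [hh]; field_simp

theorem aux_strat {Ω 𝓧 : Type*} [MeasurableSpace Ω] [MeasurableSpace 𝓧]
    (P Q : Measure Ω) [IsProbabilityMeasure P] [IsProbabilityMeasure Q]
    (D Y : Ω → ℝ) (X : Ω → 𝓧) (hD : Measurable D) (hY : Measurable Y) (hX : Measurable X)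
    (d p r : ℝ) (hp : p = (P {ω | D ω = d}).toReal) (hr : r = (Q {ω | D ω = d}).toReal)
    (hp0 : 0 < p) (hr0 : 0 < r)
    (hstrat : ∀ f : ℝ × 𝓧 → ℝ, Measurable f → (∃ C, ∀ p, |f p| ≤ C) →
      (∫ ω, (if D ω = d then (1 : ℝ) else 0) * f (Y ω, X ω) ∂P) / (P {ω | D ω = d}).toReal =
        (∫ ω, (if D ω = d then (1 : ℝ) else 0) * f (Y ω, X ω) ∂Q) /
          (Q {ω | D ω = d}).toReal)
    (f : ℝ × 𝓧 → ℝ) (hf : Measurable f) :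
    ∫ ω in {ω | D ω = d}, f (Y ω, X ω) ∂P =
      p / r * ∫ ω in {ω | D ω = d}, f (Y ω, X ω) ∂Q := by
  have hT : MeasurableSet {ω | D ω = d} := hD (measurableSet_singleton d)
  have hYX : Measurable (fun ω => (Y ω, X ω)) := hY.prodMk hX
  have hm : (P.restrict {ω | D ω = d}).map (fun ω => (Y ω, X ω)) =
      ENNReal.ofReal (p / r) • (Q.restrict {ω | D ω = d}).map (fun ω => (Y ω, X ω)) := by
    ext s hs
    have h1 := hstrat (s.indicator 1) (measurable_one.indicator hs)
      ⟨1, fun x => by by_cases hx : x ∈ s <;> simp [hx]⟩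
    have h2 : ∀ M : Measure Ω, ∫ ω, (if D ω = d then (1 : ℝ) else 0) *
        (s.indicator 1 : ℝ × 𝓧 → ℝ) (Y ω, X ω) ∂M =
        M.real ((fun ω => (Y ω, X ω)) ⁻¹' s ∩ {ω | D ω = d}) := fun M => by
      rw [← integral_indicator_one ((hYX hs).inter hT)]
      congr 1; ext ω
      by_cases h1 : D ω = d <;> by_cases h2 : (Y ω, X ω) ∈ s <;> simp [h1, h2]
    rw [h2, h2, ← hp, ← hr] at h1
    rw [Measure.smul_apply, Measure.map_apply hYX hs, Measure.map_apply hYX hs,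
      Measure.restrict_apply (hYX hs), Measure.restrict_apply (hYX hs), smul_eq_mul,
      ← ofReal_measureReal, ← ofReal_measureReal, ← ENNReal.ofReal_mul (by positivity)]
    congr 1
    field_simp at h1 ⊢
    linarith
  rw [← integral_map (μ := P.restrict _) hYX.aemeasurable hf.aestronglyMeasurable, hm,
    integral_smul_measure, integral_map hYX.aemeasurable hf.aestronglyMeasurable,
    ENNReal.toReal_ofReal (by positivity), smul_eq_mul]

/-- Under stratification on treatment status and unconfoundedness with overlap
under `P`, the reweighted inverse-propensity-score expression identifies the ATE:
`E_{P*}[(D·Y/π*(X) − (1−D)·Y/(1−π*(X)))·(π*(X)·π/π* + (1−π*(X))·(1−π)/(1−π*))] = E_P[Y₁ − Y₀]`,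
where `π*(X)` is a version of `E_{P*}[D | σ(X)]` bounded in `[c, 1−c]` `P*`-a.s. -/
theorem stmt_4 {Ω 𝓧 : Type*} [MeasurableSpace Ω] [StandardBorelSpace Ω] [MeasurableSpace 𝓧]
    (P Pstar : Measure Ω) [IsProbabilityMeasure P] [IsProbabilityMeasure Pstar]
    (D Y : Ω → ℝ) (X : Ω → 𝓧) (hD : Measurable D) (hY : Measurable Y) (hX : Measurable X)
    (hDval : ∀ ω, D ω = 0 ∨ D ω = 1)
    (π πs : ℝ) (hπdef : π = (P {ω | D ω = 1}).toReal) (hπsdef : πs = (Pstar {ω | D ω = 1}).toReal)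
    (hπ0 : 0 < π) (hπ1 : π < 1) (hπs0 : 0 < πs) (hπs1 : πs < 1)
    -- stratification: random sampling within each treatment stratum
    (hstrat : ∀ d ∈ ({0, 1} : Set ℝ), ∀ f : ℝ × 𝓧 → ℝ, Measurable f → (∃ C, ∀ p, |f p| ≤ C) →
      (∫ ω, (if D ω = d then (1 : ℝ) else 0) * f (Y ω, X ω) ∂P) / (P {ω | D ω = d}).toReal =
        (∫ ω, (if D ω = d then (1 : ℝ) else 0) * f (Y ω, X ω) ∂Pstar) /
          (Pstar {ω | D ω = d}).toReal)
    -- potential outcomes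
    (Y0 Y1 : Ω → ℝ) (hY0m : Measurable Y0) (hY1m : Measurable Y1)
    (hY0i : Integrable Y0 P) (hY1i : Integrable Y1 P)
    (hobs : ∀ ω, Y ω = D ω * Y1 ω + (1 - D ω) * Y0 ω)
    -- unconfoundedness: (Y₀, Y₁) ⫫ D | σ(X) under P
    (hunconf : CondIndepFun (MeasurableSpace.comap X inferInstance) hX.comap_le
      (fun ω => (Y0 ω, Y1 ω)) D P)
    -- overlap: 0 < E_P[D | σ(X)] < 1 P-a.s.
    (hoverlap : ∀ᵐ ω ∂P, 0 < (P[D | MeasurableSpace.comap X inferInstance]) ω ∧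
      (P[D | MeasurableSpace.comap X inferInstance]) ω < 1)
    -- π*(X) : a version of E_{P*}[D | σ(X)], bounded away from 0 and 1
    (estar : 𝓧 → ℝ) (hestarm : Measurable estar)
    (hestar : Pstar[D | MeasurableSpace.comap X inferInstance] =ᵐ[Pstar] fun ω => estar (X ω))
    (c : ℝ) (hc0 : 0 < c) (hc1 : c < 1 / 2)
    (hbound : ∀ᵐ ω ∂Pstar, c ≤ estar (X ω) ∧ estar (X ω) ≤ 1 - c)
    -- Y integrable under both P and P*
    (hYiP : Integrable Y P) (hYiPstar : Integrable Y Pstar) :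
    ∫ ω, (D ω * Y ω / estar (X ω) - (1 - D ω) * Y ω / (1 - estar (X ω))) *
        (estar (X ω) * (π / πs) + (1 - estar (X ω)) * ((1 - π) / (1 - πs))) ∂Pstar =
      ∫ ω, (Y1 ω - Y0 ω) ∂P := by
  have hT1 : MeasurableSet {ω | D ω = 1} := hD (measurableSet_singleton 1)
  have hT0 : MeasurableSet {ω | D ω = 0} := hD (measurableSet_singleton 0)
  have hc01 : {ω | D ω = 1}ᶜ = {ω | D ω = 0} := by
    ext ω; rcases hDval ω with h | h <;> simp [h]
  have hc10 : {ω | D ω = 0}ᶜ = {ω | D ω = 1} := by rw [← hc01, compl_compl]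
  have hzero : ∀ (M : Measure Ω) [IsProbabilityMeasure M],
      1 - (M {ω | D ω = 1}).toReal = (M {ω | D ω = 0}).toReal := fun M _ => by
    rw [← hc01]; exact (probReal_compl_eq_one_sub hT1).symm
  have hπ' : 1 - π = (P {ω | D ω = 0}).toReal := by rw [hπdef, hzero]
  have hπs' : 1 - πs = (Pstar {ω | D ω = 0}).toReal := by rw [hπsdef, hzero]
  have hp1 : 0 < 1 - π := by linarith
  have hr1 : 0 < 1 - πs := by linarith
  have S1 := aux_strat P Pstar D Y X hD hY hX 1 π πs hπdef hπsdef hπ0 hπs0 (hstrat 1 (by simp))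
  have S0 := aux_strat P Pstar D Y X hD hY hX 0 (1 - π) (1 - πs) hπ' hπs' hp1 hr1
    (hstrat 0 (by simp))
  have ha : 0 < π / πs := div_pos hπ0 hπs0
  have hb : 0 < (1 - π) / (1 - πs) := div_pos hp1 hr1
  have I1 : {ω | D ω = 1}.indicator (fun _ => (1:ℝ)) = D := by
    ext ω; rcases hDval ω with h | h <;> simp [h]
  have I0 : {ω | D ω = 0}.indicator (fun _ => (1:ℝ)) = (fun _ => (1:ℝ)) - D := by
    ext ω; rcases hDval ω with h | h <;> simp [h]
  have hDi : Integrable D Pstar := by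
    rw [← I1]; exact (integrable_const _).indicator hT1
  set q : 𝓧 → ℝ := fun x => max c (min (estar x) (1 - c)) with hq
  have hqm : Measurable q := by fun_prop
  have hql : ∀ x, c ≤ q x := fun x => le_max_left _ _
  have hqu : ∀ x, q x ≤ 1 - c := fun x => max_le (by linarith) (min_le_right _ _)
  have hqe : ∀ᵐ ω ∂Pstar, q (X ω) = estar (X ω) := by
    filter_upwards [hbound] with ω h
    simp only [hq]; rw [min_eq_left h.2, max_eq_right h.1]
  have E1 : Pstar[{ω | D ω = 1}.indicator (fun _ => (1:ℝ)) | MeasurableSpace.comap X inferInstance]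
      =ᵐ[Pstar] fun ω => q (X ω) := by
    rw [I1]; filter_upwards [hestar, hqe] with ω h1 h2
    rw [h1, h2]
  have E0 : Pstar[{ω | D ω = 0}.indicator (fun _ => (1:ℝ)) | MeasurableSpace.comap X inferInstance]
      =ᵐ[Pstar] fun ω => 1 - q (X ω) := by
    rw [I0]
    filter_upwards [hestar, hqe, condExp_sub (integrable_const (1:ℝ)) hDi
      (MeasurableSpace.comap X inferInstance)] with ω h1 h2 h3
    rw [h3, Pi.sub_apply, h1, h2, condExp_const hX.comap_le]
  have C1 := (condIndepFun_iff_condExp_inter_preimage_eq_mul hY1m hD).1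
    (hunconf.comp measurable_snd measurable_id)
  have C0 := (condIndepFun_iff_condExp_inter_preimage_eq_mul hY0m hD).1
    (hunconf.comp measurable_fst measurable_id)
  have R1 : ∀ (M : Measure Ω) (f : ℝ × 𝓧 → ℝ),
      ∫ ω in {ω | D ω = 1}, f (Y1 ω, X ω) ∂M = ∫ ω in {ω | D ω = 1}, f (Y ω, X ω) ∂M :=
    fun M f => setIntegral_congr_fun hT1 fun ω (h : D ω = 1) => by simp [hobs, h]
  have R0 : ∀ (M : Measure Ω) (f : ℝ × 𝓧 → ℝ),
      ∫ ω in {ω | D ω = 0}, f (Y0 ω, X ω) ∂M = ∫ ω in {ω | D ω = 0}, f (Y ω, X ω) ∂M :=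
    fun M f => setIntegral_congr_fun hT0 fun ω (h : D ω = 0) => by simp [hobs, h]
  have H1 := aux_half P Pstar X hX Y1 hY1m _ hT1 _ _ ha hb
    (fun s hs => C1 s {1} hs (measurableSet_singleton 1))
    (fun f hf => by rw [R1, R1]; exact S1 f hf)
    (fun g hg => by rw [hc01]; exact S0 (fun p => g p.2) (hg.comp measurable_snd))
    q hqm E1 c hc0 hql hqu
  have H0 := aux_half P Pstar X hX Y0 hY0m _ hT0 _ _ hb ha
    (fun s hs => C0 s {0} hs (measurableSet_singleton 0))
    (fun f hf => by rw [R0, R0]; exact S0 f hf)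
    (fun g hg => by rw [hc10]; exact S1 (fun p => g p.2) (hg.comp measurable_snd))
    (fun x => 1 - q x) (by fun_prop) E0 c hc0 (fun x => by linarith [hqu x])
    (fun x => by linarith [hql x])
  rw [integral_sub hY1i hY0i, ← H1, ← H0,
    R1 Pstar (fun p => p.1 / q p.2 * (q p.2 * (π / πs) + (1 - q p.2) * ((1 - π) / (1 - πs)))),
    R0 Pstar (fun p => p.1 / (1 - q p.2) *
      ((1 - q p.2) * ((1 - π) / (1 - πs)) + (1 - (1 - q p.2)) * (π / πs))),
    ← integral_indicator hT1, ← integral_indicator hT0]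
  generalize π / πs = a at *
  generalize (1 - π) / (1 - πs) = b at *
  have hint : ∀ r : 𝓧 → ℝ, Measurable r → (∀ x, c ≤ r x) → (∀ x, r x ≤ 1 - c) → ∀ a b : ℝ,
      0 < a → 0 < b →
      Integrable (fun ω => Y ω / r (X ω) * (r (X ω) * a + (1 - r (X ω)) * b)) Pstar := by
    intro r hr h1 h2 a b ha hb
    have : (fun ω => Y ω / r (X ω) * (r (X ω) * a + (1 - r (X ω)) * b)) =
        fun ω => ((r (X ω) * a + (1 - r (X ω)) * b) / r (X ω)) * Y ω := by
      ext ω; ring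
    rw [this]
    refine hYiPstar.bdd_mul (c := (a + b) / c) ?_ (Filter.Eventually.of_forall fun ω => ?_)
    · exact Measurable.aestronglyMeasurable (by fun_prop)
    · have p0 : 0 < r (X ω) := hc0.trans_le (h1 _)
      have p1 : 0 < 1 - r (X ω) := by linarith [h2 (X ω)]
      have := mul_pos p0 ha
      have := mul_pos p1 hb
      rw [Real.norm_eq_abs, abs_of_nonneg (by positivity)]
      apply div_le_div₀ (by positivity) _ hc0 (h1 _)
      nlinarith [mul_pos p1 ha, mul_pos p0 hb]
  rw [← integral_sub ((hint q hqm hql hqu a b ha hb).indicator hT1)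
    ((hint (fun x => 1 - q x) (by fun_prop) (fun x => by linarith [hqu x])
      (fun x => by linarith [hql x]) b a hb ha).indicator hT0)]
  apply integral_congr_ae
  filter_upwards [hqe] with ω h
  rcases hDval ω with h' | h'
  · simp [h', h, add_comm]
  · simp [h', h]
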